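/- Let μ ∈ P_2(ℝ) be compactly supported. Then the log-concave Wasserstein projection proj_{F_lc} μ is compactly supported. -/

import Mathlib

open MeasureTheory Set Filter

noncomputable def quantile (μ : MeasureTheory.Measure ℝ) (u : ℝ) : ℝ :=
  sInf {x : ℝ | u ≤ (μ (Set.Iic x)).toReal}

def HasFiniteMomentP (p : ℝ) (μ : MeasureTheory.Measure ℝ) : Prop :=
  MeasureTheory.IsProbabilityMeasure μ ∧
    MeasureTheory.Integrable (fun x => |x| ^ p) μ

noncomputable def Wdist (p : ℝ) (μ ν : MeasureTheory.Measure ℝ) : ℝ :=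
  (∫ u in Set.Ioo (0:ℝ) 1, |quantile μ u - quantile ν u| ^ p) ^ (1 / p)

def DisplacementConvex (F : Set (MeasureTheory.Measure ℝ)) : Prop :=
  ∀ μ ∈ F, ∀ ν ∈ F, ∀ t ∈ Set.Icc (0:ℝ) 1, ∃ σ ∈ F,
    ∀ u ∈ Set.Ioo (0:ℝ) 1,
      quantile σ u = (1 - t) * quantile μ u + t * quantile ν u

def WClosed (p : ℝ) (F : Set (MeasureTheory.Measure ℝ)) : Prop :=
  ∀ (μs : ℕ → MeasureTheory.Measure ℝ) (μ : MeasureTheory.Measure ℝ),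
    (∀ n, μs n ∈ F) → HasFiniteMomentP p μ →
    Filter.Tendsto (fun n => Wdist p (μs n) μ) Filter.atTop (nhds 0) → μ ∈ F

/-- A Borel probability measure on `ℝ` is log-concave if it is a point mass, or it has a
density `f` with respect to Lebesgue measure such that `log f : ℝ → [−∞, ∞)` is concave;
the latter is expressed by the multiplicative inequality
`f((1−t)x + ty) ≥ f(x)^(1−t) · f(y)^t`. -/
def IsLogConcave (μ : MeasureTheory.Measure ℝ) : Prop :=
  (∃ x : ℝ, μ = MeasureTheory.Measure.dirac x) ∨
  ∃ f : ℝ → ℝ, (∀ x, 0 ≤ f x) ∧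
    μ = MeasureTheory.volume.withDensity (fun x => ENNReal.ofReal (f x)) ∧
    ∀ x y : ℝ, ∀ t ∈ Set.Icc (0:ℝ) 1,
      f x ^ (1 - t) * f y ^ t ≤ f ((1 - t) * x + t * y)

/-- The set `F_lc` of log-concave probability measures on `ℝ`. -/
def Flc : Set (MeasureTheory.Measure ℝ) :=
  {μ | MeasureTheory.IsProbabilityMeasure μ ∧ IsLogConcave μ}

open ProbabilityTheory in
/-- The Galois connection between the quantile function and the distribution function. -/
theorem quantile_le_iff (μ : Measure ℝ) [IsProbabilityMeasure μ] {u : ℝ} (hu : u ∈ Ioo (0 : ℝ) 1)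
    (x : ℝ) : quantile μ u ≤ x ↔ u ≤ μ.real (Iic x) := by
  have hcdf : ∀ y, cdf μ y = μ.real (Iic y) := cdf_eq_real μ
  have hbdd : BddBelow {y : ℝ | u ≤ (μ (Iic y)).toReal} := by
    obtain ⟨a, ha⟩ := ((tendsto_cdf_atBot μ).eventually_lt_const hu.1).exists
    refine ⟨a, fun y hy => le_of_not_gt fun hya => ?_⟩
    have hmono := monotone_cdf μ hya.le
    rw [hcdf y] at hmono
    exact absurd (hmono.trans_lt ha) (not_lt.2 hy)
  have hne : {y : ℝ | u ≤ (μ (Iic y)).toReal}.Nonempty := by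
    obtain ⟨a, ha⟩ := ((tendsto_cdf_atTop μ).eventually_const_lt hu.2).exists
    rw [hcdf a] at ha
    exact ⟨a, ha.le⟩
  have hattained : u ≤ μ.real (Iic (quantile μ u)) := by
    rw [← hcdf]
    have hright : Tendsto (cdf μ) (nhdsWithin (quantile μ u) (Ioi (quantile μ u)))
        (nhds (cdf μ (quantile μ u))) :=
      ((cdf μ).right_continuous (quantile μ u)).mono_left (nhdsWithin_mono _ Ioi_subset_Ici_self)
    refine ge_of_tendsto hright ?_
    filter_upwards [self_mem_nhdsWithin] with y hy
    obtain ⟨z, hz, hzy⟩ := exists_lt_of_csInf_lt hne hy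
    have hmono := monotone_cdf μ hzy.le
    rw [hcdf z] at hmono
    exact le_trans hz hmono
  exact ⟨fun h => hattained.trans (measureReal_mono (Iic_subset_Iic.2 h)),
    fun h => csInf_le hbdd h⟩

theorem monotoneOn_quantile (μ : Measure ℝ) [IsProbabilityMeasure μ] :
    MonotoneOn (quantile μ) (Ioo 0 1) := fun _ hu _ hv huv =>
  (quantile_le_iff μ hu _).2 (huv.trans ((quantile_le_iff μ hv _).1 le_rfl))

theorem aemeasurable_quantile (μ : Measure ℝ) [IsProbabilityMeasure μ] :
    AEMeasurable (quantile μ) (volume.restrict (Ioo 0 1)) :=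
  aemeasurable_restrict_of_monotoneOn measurableSet_Ioo (monotoneOn_quantile μ)

/-- The quantile transform. -/
theorem map_quantile (μ : Measure ℝ) [IsProbabilityMeasure μ] :
    (volume.restrict (Ioo (0 : ℝ) 1)).map (quantile μ) = μ := by
  have hfin : IsFiniteMeasure (volume.restrict (Ioo (0 : ℝ) 1)) := ⟨by simp⟩
  refine Measure.ext_of_Iic _ _ fun x => ?_
  rw [Measure.map_apply_of_aemeasurable (aemeasurable_quantile μ) measurableSet_Iic,
    Measure.restrict_apply₀' measurableSet_Ioo.nullMeasurableSet]
  have hset : quantile μ ⁻¹' Iic x ∩ Ioo 0 1 = Ioo 0 1 ∩ Iic (μ.real (Iic x)) := by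
    ext u
    constructor
    · rintro ⟨hx, hu⟩
      exact ⟨hu, (quantile_le_iff μ hu x).1 hx⟩
    · rintro ⟨hu, hx⟩
      exact ⟨(quantile_le_iff μ hu x).2 hx, hu⟩
  have hIoc : (Ioo 0 1 ∩ Iic (μ.real (Iic x)) : Set ℝ) =ᵐ[volume]
      (Ioc 0 1 ∩ Iic (μ.real (Iic x)) : Set ℝ) := Ioo_ae_eq_Ioc.inter (ae_eq_refl _)
  rw [hset, measure_congr hIoc, Ioc_inter_Iic,
    min_eq_right measureReal_le_one, Real.volume_Ioc, sub_zero, ofReal_measureReal]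

theorem quantile_le_quantile {μ ν : Measure ℝ} [IsProbabilityMeasure μ] [IsProbabilityMeasure ν]
    (h : ∀ x, μ.real (Iic x) ≤ ν.real (Iic x)) {u : ℝ} (hu : u ∈ Ioo (0 : ℝ) 1) :
    quantile ν u ≤ quantile μ u :=
  (quantile_le_iff ν hu _).2 (((quantile_le_iff μ hu _).1 le_rfl).trans (h _))

theorem abs_quantile_le {μ : Measure ℝ} [IsProbabilityMeasure μ] {M : ℝ}
    (h : μ (Icc (-M) M)ᶜ = 0) {u : ℝ} (hu : u ∈ Ioo (0 : ℝ) 1) : |quantile μ u| ≤ M := by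
  refine abs_le.2 ⟨le_of_not_gt fun hlt => ?_, (quantile_le_iff μ hu M).2 ?_⟩
  · have hpos := hu.1.trans_le ((quantile_le_iff μ hu _).1 le_rfl)
    have hzero : μ (Iic (quantile μ u)) = 0 :=
      measure_mono_null
        (show _ ⊆ (Icc (-M) M)ᶜ from fun y hy hy' => absurd (hy'.1.trans hy) (not_le.2 hlt)) h
    simp [measureReal_def, hzero] at hpos
  · have hzero : μ (Iic M)ᶜ = 0 := measure_mono_null
      (show _ ⊆ (Icc (-M) M)ᶜ from fun y hy hy' => hy hy'.2) h
    rw [measureReal_def, (prob_compl_eq_zero_iff measurableSet_Iic).1 hzero]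
    exact hu.2.le

theorem memLp_quantile {μ : Measure ℝ} [IsProbabilityMeasure μ]
    (h : Integrable (fun x => x ^ 2) μ) :
    MemLp (quantile μ) 2 (volume.restrict (Ioo 0 1)) := by
  have hid : MemLp id 2 ((volume.restrict (Ioo (0 : ℝ) 1)).map (quantile μ)) := by
    rw [map_quantile]
    exact (memLp_two_iff_integrable_sq aestronglyMeasurable_id).2 h
  exact hid.comp_of_map (aemeasurable_quantile μ)

theorem integral_quantile (μ : Measure ℝ) [IsProbabilityMeasure μ] {g : ℝ → ℝ}
    (hg : Continuous g) : ∫ u in Ioo (0 : ℝ) 1, g (quantile μ u) = ∫ x, g x ∂μ := by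
  conv_rhs => rw [← map_quantile μ]
  rw [integral_map (aemeasurable_quantile μ) hg.aestronglyMeasurable]

theorem integral_sq_quantile_sub_le_of_Wdist_le {μ ρ ν : Measure ℝ}
    (h : Wdist 2 ρ μ ≤ Wdist 2 ν μ) :
    ∫ u in Ioo (0 : ℝ) 1, (quantile ρ u - quantile μ u) ^ 2 ≤
      ∫ u in Ioo (0 : ℝ) 1, (quantile ν u - quantile μ u) ^ 2 := by
  simp only [Wdist, Real.rpow_two, sq_abs] at h
  exact (Real.rpow_le_rpow_iff (integral_nonneg fun _ => sq_nonneg _)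
    (integral_nonneg fun _ => sq_nonneg _) (by norm_num)).1 h

/-- If conditioning `ρ` on `S` moves its quantiles towards those of `μ`, all of which lie on one
side of `m`, and does not decrease the distance to `μ`, then `ρ` has no mass far from `m`
outside `S`. -/
theorem measure_compl_eq_zero_of_Wdist_le_cond {μ ρ : Measure ℝ} [IsProbabilityMeasure μ]
    [IsProbabilityMeasure ρ] (hμ : Integrable (fun x => x ^ 2) μ)
    (hρ : Integrable (fun x => x ^ 2) ρ) {S : Set ℝ} (hS : MeasurableSet S) (hS0 : ρ S ≠ 0)
    (hle : Wdist 2 ρ μ ≤ Wdist 2 (ProbabilityTheory.cond ρ S) μ) {m R : ℝ}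
    (hside : ∀ u ∈ Ioo (0 : ℝ) 1,
      0 ≤ (quantile ρ u - quantile (ProbabilityTheory.cond ρ S) u) * (m - quantile μ u))
    (hfar : ∀ x ∈ Sᶜ, R ≤ (x - m) ^ 2) (hR : ∫ x, (x - m) ^ 2 ∂ρ < R) : ρ Sᶜ = 0 := by
  have hνprob := ProbabilityTheory.cond_isProbabilityMeasure (μ := ρ) hS0
  have hν : Integrable (fun x => x ^ 2) (ProbabilityTheory.cond ρ S) :=
    hρ.restrict.smul_measure (ENNReal.inv_ne_top.2 hS0)
  have hQρ := memLp_quantile hρ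
  have hQμ := memLp_quantile hμ
  have hQν := memLp_quantile hν
  have hfin : IsFiniteMeasure (volume.restrict (Ioo (0 : ℝ) 1)) := ⟨by simp⟩
  have hm : MemLp (fun _ : ℝ => m) 2 (volume.restrict (Ioo (0 : ℝ) 1)) := memLp_const m
  have hcost : ∫ x, (x - m) ^ 2 ∂ρ ≤ ∫ x, (x - m) ^ 2 ∂(ProbabilityTheory.cond ρ S) := by
    rw [← integral_quantile ρ (by fun_prop : Continuous fun x : ℝ => (x - m) ^ 2),
      ← integral_quantile (ProbabilityTheory.cond ρ S)
        (by fun_prop : Continuous fun x : ℝ => (x - m) ^ 2)]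
    have hsum : ∫ u in Ioo (0 : ℝ) 1, ((quantile ρ u - m) ^ 2 +
          (quantile (ProbabilityTheory.cond ρ S) u - quantile μ u) ^ 2) ≤
        ∫ u in Ioo (0 : ℝ) 1, ((quantile (ProbabilityTheory.cond ρ S) u - m) ^ 2 +
          (quantile ρ u - quantile μ u) ^ 2) := by
      refine setIntegral_mono_on ((hQρ.sub hm).integrable_sq.add (hQν.sub hQμ).integrable_sq)
        ((hQν.sub hm).integrable_sq.add (hQρ.sub hQμ).integrable_sq) measurableSet_Ioo
        fun u hu => ?_
      linarith [hside u hu]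
    have hadd₁ := integral_add (hQρ.sub hm).integrable_sq (hQν.sub hQμ).integrable_sq
    have hadd₂ := integral_add (hQν.sub hm).integrable_sq (hQρ.sub hQμ).integrable_sq
    simp only [Pi.sub_apply] at hadd₁ hadd₂
    rw [hadd₁, hadd₂] at hsum
    linarith [integral_sq_quantile_sub_le_of_Wdist_le hle]
  have hint : Integrable (fun x => (x - m) ^ 2) ρ :=
    (((memLp_two_iff_integrable_sq aestronglyMeasurable_id).2 hρ).sub (memLp_const m)).integrable_sq
  have hpos : 0 < ρ.real S := ENNReal.toReal_pos hS0 (measure_ne_top _ _)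
  rw [ProbabilityTheory.cond, integral_smul_measure, ENNReal.toReal_inv, smul_eq_mul,
    ← measureReal_def, ← div_eq_inv_mul, le_div_iff₀ hpos] at hcost
  have htail : R * ρ.real Sᶜ ≤ ∫ x in Sᶜ, (x - m) ^ 2 ∂ρ :=
    setIntegral_ge_of_const_le_real hS.compl (measure_ne_top _ _) hfar hint.integrableOn
  have hsplit := integral_add_compl hS hint
  have hmass : ρ.real Sᶜ = 1 - ρ.real S := probReal_compl_eq_one_sub hS
  refine (measureReal_eq_zero_iff (μ := ρ)).1 ?_
  have hnn : 0 ≤ ρ.real Sᶜ := measureReal_nonneg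
  have hS1 : ρ.real S = 1 - ρ.real Sᶜ := by linarith
  rw [hS1] at hcost
  nlinarith

theorem real_cond_apply (ρ : Measure ℝ) {S : Set ℝ} (hS : MeasurableSet S) (T : Set ℝ) :
    (ProbabilityTheory.cond ρ S).real T = ρ.real (S ∩ T) / ρ.real S := by
  rw [measureReal_def, ProbabilityTheory.cond_apply hS, ENNReal.toReal_mul, ENNReal.toReal_inv,
    div_eq_inv_mul, measureReal_def, measureReal_def]

theorem quantile_cond_Iic_le (ρ : Measure ℝ) [IsProbabilityMeasure ρ] {b : ℝ}
    (hb : ρ (Iic b) ≠ 0) {u : ℝ} (hu : u ∈ Ioo (0 : ℝ) 1) :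
    quantile (ProbabilityTheory.cond ρ (Iic b)) u ≤ quantile ρ u := by
  have hνprob := ProbabilityTheory.cond_isProbabilityMeasure hb
  have hpos : 0 < ρ.real (Iic b) := ENNReal.toReal_pos hb (measure_ne_top _ _)
  refine quantile_le_quantile (fun x => ?_) hu
  rw [real_cond_apply ρ measurableSet_Iic, le_div_iff₀ hpos, Iic_inter_Iic]
  rcases le_total b x with hbx | hxb
  · rw [inf_eq_left.2 hbx]
    exact mul_le_of_le_one_left hpos.le measureReal_le_one
  · rw [inf_eq_right.2 hxb]
    exact mul_le_of_le_one_right measureReal_nonneg measureReal_le_one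

theorem le_quantile_cond_Ici (ρ : Measure ℝ) [IsProbabilityMeasure ρ] {a : ℝ}
    (ha : ρ (Ici a) ≠ 0) {u : ℝ} (hu : u ∈ Ioo (0 : ℝ) 1) :
    quantile ρ u ≤ quantile (ProbabilityTheory.cond ρ (Ici a)) u := by
  have hνprob := ProbabilityTheory.cond_isProbabilityMeasure ha
  have hpos : 0 < ρ.real (Ici a) := ENNReal.toReal_pos ha (measure_ne_top _ _)
  refine quantile_le_quantile (fun x => ?_) hu
  rw [real_cond_apply ρ measurableSet_Ici, div_le_iff₀ hpos, Ici_inter_Iic]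
  rcases le_or_gt a x with hax | hxa
  · have hIio : ρ.real (Iio a) = 1 - ρ.real (Ici a) := by
      rw [← compl_Ici, probReal_compl_eq_one_sub measurableSet_Ici]
    have hunion : ρ.real (Iic x) = ρ.real (Iio a) + ρ.real (Icc a x) := by
      rw [← measureReal_union _ measurableSet_Icc, Iio_union_Icc_eq_Iic hax]
      exact disjoint_left.2 fun y hy hy' => absurd hy'.1 (not_le.2 hy)
    have hle : ρ.real (Iic x) ≤ 1 := measureReal_le_one
    have hle' : ρ.real (Ici a) ≤ 1 := measureReal_le_one
    nlinarith
  · rw [Icc_eq_empty (not_le.2 hxa), measureReal_empty]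
    exact mul_nonneg measureReal_nonneg hpos.le

/-- Log-concavity of a nonnegative function, in multiplicative form. -/
def LogConcaveFun (f : ℝ → ℝ) : Prop :=
  ∀ x y : ℝ, ∀ t ∈ Icc (0 : ℝ) 1, f x ^ (1 - t) * f y ^ t ≤ f ((1 - t) * x + t * y)

theorem LogConcaveFun.measurable {f : ℝ → ℝ} (hf : LogConcaveFun f) (hf0 : ∀ x, 0 ≤ f x) :
    Measurable f := by
  refine measurable_of_Ici fun c => ?_
  rcases le_or_gt c 0 with hc | hc
  · have huniv : f ⁻¹' Ici c = univ := eq_univ_of_forall fun x => hc.trans (hf0 x)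
    rw [huniv]
    exact MeasurableSet.univ
  · refine Set.OrdConnected.measurableSet (Convex.ordConnected fun x hx y hy a b ha hb hab => ?_)
    obtain rfl : a = 1 - b := by linarith
    refine le_trans ?_ (hf x y b ⟨hb, by linarith⟩)
    calc c = c ^ (1 - b) * c ^ b := by rw [← Real.rpow_add hc, sub_add_cancel, Real.rpow_one]
      _ ≤ f x ^ (1 - b) * f y ^ b := mul_le_mul (Real.rpow_le_rpow hc.le hx ha)
        (Real.rpow_le_rpow hc.le hy hb) (by positivity) (Real.rpow_nonneg (hf0 x) _)

theorem LogConcaveFun.comp_neg {f : ℝ → ℝ} (hf : LogConcaveFun f) :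
    LogConcaveFun fun x => f (-x) := fun x y t ht => by
  convert hf (-x) (-y) t ht using 2
  ring

theorem LogConcaveFun.const_mul_indicator {f : ℝ → ℝ} (hf : LogConcaveFun f)
    (hf0 : ∀ x, 0 ≤ f x) {c : ℝ} (hc : 0 < c) {S : Set ℝ} (hS : Convex ℝ S) :
    LogConcaveFun fun x => c * S.indicator f x := by
  intro x y t ht
  have hnn : ∀ z, 0 ≤ c * S.indicator f z := fun z =>
    mul_nonneg hc.le (indicator_nonneg (fun a _ => hf0 a) z)
  rcases ht.1.eq_or_lt with rfl | ht0
  · simp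
  rcases ht.2.eq_or_lt with rfl | ht1
  · simp
  by_cases hx : x ∈ S
  · by_cases hy : y ∈ S
    · have hz : (1 - t) * x + t * y ∈ S := hS hx hy (by linarith) ht.1 (by ring)
      simp only [indicator_of_mem hx, indicator_of_mem hy, indicator_of_mem hz]
      rw [Real.mul_rpow hc.le (hf0 x), Real.mul_rpow hc.le (hf0 y), mul_mul_mul_comm,
        ← Real.rpow_add hc, sub_add_cancel, Real.rpow_one]
      exact mul_le_mul_of_nonneg_left (hf x y t ht) hc.le
    · refine le_of_eq_of_le ?_ (hnn _)
      simp [indicator_of_notMem hy, Real.zero_rpow ht0.ne']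
  · refine le_of_eq_of_le ?_ (hnn _)
    simp [indicator_of_notMem hx, Real.zero_rpow (sub_pos.2 ht1).ne']

theorem LogConcaveFun.exists_le_exp {f : ℝ → ℝ} (hf : LogConcaveFun f) (hf0 : ∀ x, 0 ≤ f x)
    (hint : Integrable f) :
    ∃ A C k : ℝ, 0 < k ∧ 0 ≤ C ∧ ∀ x, A < x → f x ≤ C * Real.exp (-k * x) := by
  by_cases hzero : ∀ x, f x = 0
  · exact ⟨0, 0, 1, one_pos, le_rfl, fun x _ => by simp [hzero x]⟩
  push Not at hzero
  obtain ⟨x₀, hx₀⟩ := hzero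
  have hpos : 0 < f x₀ := (hf0 x₀).lt_of_ne' hx₀
  obtain ⟨x₁, hx₁, hlt⟩ : ∃ x₁, x₀ < x₁ ∧ f x₁ < f x₀ := by
    by_contra! hge
    have hconst : IntegrableOn (fun _ : ℝ => f x₀) (Ioi x₀) := by
      refine Integrable.mono' hint.integrableOn aestronglyMeasurable_const ?_
      filter_upwards [ae_restrict_mem measurableSet_Ioi] with x hx
      rw [Real.norm_of_nonneg hpos.le]
      exact hge x hx
    rw [integrableOn_const_iff] at hconst
    simp [hx₀] at hconst
  obtain ⟨c, hc₁, hc₀⟩ := exists_between hlt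
  have hc : 0 < c := (hf0 x₁).trans_lt hc₁
  have hd : 0 < x₁ - x₀ := sub_pos.2 hx₁
  set k := (Real.log (f x₀) - Real.log c) / (x₁ - x₀) with hk
  refine ⟨x₁, f x₀ * Real.exp (k * x₀), k,
    div_pos (sub_pos.2 (Real.log_lt_log hc hc₀)) hd, by positivity, fun x hx => ?_⟩
  rw [mul_assoc, ← Real.exp_add]
  rcases (hf0 x).eq_or_lt with hfx | hfx
  · rw [← hfx]
    positivity
  have hdx : 0 < x - x₀ := by linarith
  set t := (x₁ - x₀) / (x - x₀) with ht
  have ht0 : 0 < t := div_pos hd hdx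
  have ht1 : t ≤ 1 := (div_le_one hdx).2 (by linarith)
  have htx : t * (x - x₀) = x₁ - x₀ := div_mul_cancel₀ _ hdx.ne'
  have hkd : k * (x₁ - x₀) = Real.log (f x₀) - Real.log c := div_mul_cancel₀ _ hd.ne'
  have hineq := hf x₀ x t ⟨ht0.le, ht1⟩
  rw [show (1 - t) * x₀ + t * x = x₁ by linarith] at hineq
  have hlog := Real.log_le_log (by positivity) (hineq.trans hc₁.le)
  rw [Real.log_mul (by positivity) (by positivity), Real.log_rpow hpos, Real.log_rpow hfx] at hlog
  rw [← Real.log_le_log_iff hfx (by positivity), Real.log_mul hpos.ne' (Real.exp_pos _).ne',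
    Real.log_exp]
  refine le_of_mul_le_mul_left ?_ ht0
  have hkt : k * (t * (x - x₀)) = Real.log (f x₀) - Real.log c := by rw [htx, hkd]
  linarith

theorem LogConcaveFun.integrableOn_Ioi_sq_mul {f : ℝ → ℝ} (hf : LogConcaveFun f)
    (hf0 : ∀ x, 0 ≤ f x) (hint : Integrable f) :
    IntegrableOn (fun x => x ^ 2 * f x) (Ioi 0) := by
  obtain ⟨A, C, k, hk, hC, hbound⟩ := hf.exists_le_exp hf0 hint
  have hmeas : Measurable fun x => x ^ 2 * f x :=
    (measurable_id.pow_const 2).mul (hf.measurable hf0)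
  have hA : 0 ≤ max A 0 := le_max_right _ _
  rw [← Ioc_union_Ioi_eq_Ioi hA]
  refine IntegrableOn.union ?_ ?_
  · refine Integrable.mono' (hint.const_mul (max A 0 ^ 2)).integrableOn
      hmeas.aestronglyMeasurable ?_
    filter_upwards [ae_restrict_mem measurableSet_Ioc] with x hx
    rw [Real.norm_of_nonneg (mul_nonneg (sq_nonneg x) (hf0 x))]
    exact mul_le_mul_of_nonneg_right (pow_le_pow_left₀ hx.1.le hx.2 2) (hf0 x)
  · refine Integrable.mono' ((exp_neg_integrableOn_Ioi (max A 0) (half_pos hk)).const_mul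
      (8 / k ^ 2 * C)) hmeas.aestronglyMeasurable ?_
    filter_upwards [ae_restrict_mem measurableSet_Ioi] with x hx
    have hx0 : 0 < x := hA.trans_lt hx
    rw [Real.norm_of_nonneg (mul_nonneg (sq_nonneg x) (hf0 x))]
    have hsq : x ^ 2 ≤ 8 / k ^ 2 * Real.exp (k / 2 * x) := by
      have hexp := Real.pow_div_factorial_le_exp (k / 2 * x) (by positivity) 2
      rw [div_mul_eq_mul_div, le_div_iff₀ (by positivity)]
      norm_num [Nat.factorial] at hexp
      nlinarith
    calc x ^ 2 * f x ≤ 8 / k ^ 2 * Real.exp (k / 2 * x) * (C * Real.exp (-k * x)) :=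
          mul_le_mul hsq (hbound x ((le_max_left _ _).trans_lt hx)) (hf0 x) (by positivity)
      _ = 8 / k ^ 2 * C * (Real.exp (k / 2 * x) * Real.exp (-k * x)) := by ring
      _ = 8 / k ^ 2 * C * Real.exp (-(k / 2) * x) := by
          rw [← Real.exp_add]
          ring_nf

theorem LogConcaveFun.integrable_sq_mul {f : ℝ → ℝ} (hf : LogConcaveFun f)
    (hf0 : ∀ x, 0 ≤ f x) (hint : Integrable f) : Integrable fun x => x ^ 2 * f x := by
  have hneg := (hf.comp_neg).integrableOn_Ioi_sq_mul (fun x => hf0 (-x)) hint.comp_neg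
  have hIio : IntegrableOn (fun x => x ^ 2 * f x) (Iio 0) := by
    have hcomp := hneg.comp_neg
    simpa using hcomp
  rw [← integrableOn_univ, ← Iic_union_Ioi (a := (0 : ℝ)), integrableOn_union,
    integrableOn_Iic_iff_integrableOn_Iio]
  exact ⟨hIio, hf.integrableOn_Ioi_sq_mul hf0 hint⟩

theorem LogConcaveFun.integrable_sq_withDensity {f : ℝ → ℝ} (hf : LogConcaveFun f)
    (hf0 : ∀ x, 0 ≤ f x)
    [IsProbabilityMeasure (volume.withDensity fun x => ENNReal.ofReal (f x))] :
    Integrable (fun x => x ^ 2) (volume.withDensity fun x => ENNReal.ofReal (f x)) := by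
  have hmeas := hf.measurable hf0
  have hint : Integrable f := by
    refine ⟨hmeas.aestronglyMeasurable, ?_⟩
    rw [hasFiniteIntegral_iff_ofReal (Eventually.of_forall hf0)]
    have hone := measure_univ (μ := volume.withDensity fun x => ENNReal.ofReal (f x))
    rw [withDensity_apply _ MeasurableSet.univ, setLIntegral_univ] at hone
    simp [hone]
  rw [integrable_withDensity_iff hmeas.ennreal_ofReal (by simp)]
  simpa only [ENNReal.toReal_ofReal (hf0 _)] using hf.integrable_sq_mul hf0 hint

theorem cond_mem_Flc {f : ℝ → ℝ} (hf : LogConcaveFun f) (hf0 : ∀ x, 0 ≤ f x)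
    [IsProbabilityMeasure (volume.withDensity fun x => ENNReal.ofReal (f x))]
    {S : Set ℝ} (hS : Convex ℝ S)
    (hS0 : (volume.withDensity fun x => ENNReal.ofReal (f x)) S ≠ 0) :
    ProbabilityTheory.cond (volume.withDensity fun x => ENNReal.ofReal (f x)) S ∈ Flc := by
  set ρ := volume.withDensity fun x => ENNReal.ofReal (f x) with hρ
  have hSm : MeasurableSet S := hS.ordConnected.measurableSet
  have hc : 0 < (ρ S)⁻¹.toReal :=
    ENNReal.toReal_pos (ENNReal.inv_ne_zero.2 (measure_ne_top _ _)) (ENNReal.inv_ne_top.2 hS0)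
  have hmeas := hf.measurable hf0
  refine ⟨ProbabilityTheory.cond_isProbabilityMeasure hS0, Or.inr
    ⟨fun x => (ρ S)⁻¹.toReal * S.indicator f x,
      fun x => mul_nonneg hc.le (indicator_nonneg (fun a _ => hf0 a) x), ?_,
      hf.const_mul_indicator hf0 hc hS⟩⟩
  rw [ProbabilityTheory.cond, hρ, restrict_withDensity hSm, ← withDensity_indicator hSm,
    ← withDensity_smul _ (hmeas.ennreal_ofReal.indicator hSm), ← hρ]
  congr 1
  funext x
  rw [ENNReal.ofReal_mul hc.le, ENNReal.ofReal_toReal (ENNReal.inv_ne_top.2 hS0)]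
  by_cases hx : x ∈ S <;> simp [hx]

/-- Proposition 4.6(ii). If `μ ∈ P_2(ℝ)` is compactly supported, then
the log-concave Wasserstein projection of `μ` (any minimizer of `ν ↦ W_2(ν, μ)` over
`F_lc`) is compactly supported. -/
theorem wasserstein_projection_logConcave_compact_support
    (μ : MeasureTheory.Measure ℝ) (hμ : HasFiniteMomentP 2 μ)
    (M : ℝ) (hsupp : μ (Set.Icc (-M) M)ᶜ = 0)
    (μhat : MeasureTheory.Measure ℝ)
    (hμhatF : μhat ∈ Flc)
    (hμhatmin : ∀ ν ∈ Flc, Wdist 2 μhat μ ≤ Wdist 2 ν μ) :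
    ∃ M' : ℝ, μhat (Set.Icc (-M') M')ᶜ = 0 := by
  have hμprob := hμ.1
  have hμ2 : Integrable (fun x => x ^ 2) μ := by
    simpa only [Real.rpow_two, sq_abs] using hμ.2
  obtain ⟨hprob, ⟨x, rfl⟩ | ⟨f, hf0, rfl, hf⟩⟩ := hμhatF
  · refine ⟨|x|, ?_⟩
    rw [Measure.dirac_apply' _ measurableSet_Icc.compl,
      indicator_of_notMem (not_not.2 ⟨neg_abs_le x, le_abs_self x⟩)]
  replace hf : LogConcaveFun f := hf
  set ρ := volume.withDensity fun x => ENNReal.ofReal (f x) with hρ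
  have hρ2 : Integrable (fun x => x ^ 2) ρ := hf.integrable_sq_withDensity hf0
  have hupper : ∃ b, ρ (Iic b)ᶜ = 0 := by
    have hsq : Tendsto (fun b : ℝ => (b - M) ^ 2) atTop atTop :=
      (tendsto_pow_atTop two_ne_zero).comp (tendsto_atTop_add_const_right _ (-M) tendsto_id)
    obtain ⟨b, hb0, hbM, hbig⟩ := (((tendsto_measure_Iic_atTop ρ).eventually_ne
      (by simp : ρ univ ≠ 0)).and ((eventually_ge_atTop M).and
        (hsq.eventually_gt_atTop (∫ x, (x - M) ^ 2 ∂ρ)))).exists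
    refine ⟨b, measure_compl_eq_zero_of_Wdist_le_cond hμ2 hρ2 measurableSet_Iic hb0
      (hμhatmin _ (cond_mem_Flc hf hf0 (convex_Iic b) hb0)) (fun u hu => ?_) (fun x hx => ?_) hbig⟩
    · exact mul_nonneg (sub_nonneg.2 (quantile_cond_Iic_le ρ hb0 hu))
        (sub_nonneg.2 (abs_le.1 (abs_quantile_le hsupp hu)).2)
    · have hbx : b < x := not_le.1 hx
      exact pow_le_pow_left₀ (sub_nonneg.2 hbM) (by linarith) 2
  have hlower : ∃ a, ρ (Ici a)ᶜ = 0 := by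
    have hsq : Tendsto (fun a : ℝ => (a - -M) ^ 2) atBot atTop := by
      refine ((tendsto_pow_atTop two_ne_zero).comp
        (tendsto_atTop_add_const_right _ (-M) tendsto_neg_atBot_atTop)).congr fun a => ?_
      simp only [Function.comp_apply]
      ring
    obtain ⟨a, ha0, haM, hbig⟩ := (((tendsto_measure_Ici_atBot ρ).eventually_ne
      (by simp : ρ univ ≠ 0)).and ((eventually_le_atBot (-M)).and
        (hsq.eventually_gt_atTop (∫ x, (x - -M) ^ 2 ∂ρ)))).exists
    refine ⟨a, measure_compl_eq_zero_of_Wdist_le_cond hμ2 hρ2 measurableSet_Ici ha0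
      (hμhatmin _ (cond_mem_Flc hf hf0 (convex_Ici a) ha0)) (fun u hu => ?_) (fun x hx => ?_) hbig⟩
    · exact mul_nonneg_of_nonpos_of_nonpos (sub_nonpos.2 (le_quantile_cond_Ici ρ ha0 hu))
        (sub_nonpos.2 (abs_le.1 (abs_quantile_le hsupp hu)).1)
    · have hxa : x < a := not_le.1 hx
      nlinarith
  obtain ⟨b, hb⟩ := hupper
  obtain ⟨a, ha⟩ := hlower
  refine ⟨max (-a) b, measure_mono_null ?_ (measure_union_null ha hb)⟩
  rw [← compl_inter, compl_subset_compl]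
  rintro x ⟨hax, hxb⟩
  exact ⟨(neg_le.1 (le_max_left _ _)).trans hax, hxb.trans (le_max_right _ _)⟩
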